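/- Let μ be a positive finite Borel measure on (0,1) and let 1 ≤ p < ∞. The operator H_μ is bounded on l^p (i.e., there is a constant M such that ∑_{n=0}^∞ |H_μ(a)(n)|^p ≤ M^p ∑_{m=0}^∞ |a_m|^p for all a ∈ l^p) if and only if C_μ(p) = ∫_{(0,1)} (1-t)^{1/p - 1} t^{-1/p} dμ(t) < ∞; moreover, when H_μ is bounded on l^p, its operator norm equals C_μ(p). -/

import Mathlib

open MeasureTheory Set

/-- The generalized Hilbert matrix operator `H_μ` induced by a measure `μ` on `(0,1)`:
`H_μ(a)(n) = ∑_m ∫_{(0,1)} C(n+m, m) t^m (1-t)^n a_m dμ(t)`. -/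
noncomputable def Hmu (μ : Measure ℝ) (a : ℕ → ℂ) (n : ℕ) : ℂ :=
  ∑' m : ℕ, ∫ t in Ioo (0 : ℝ) 1, ((((n + m).choose m : ℝ)) * t ^ m * (1 - t) ^ n) • a m ∂μ

/-- the kernel -/
noncomputable def kk (n m : ℕ) (t : ℝ) : ℝ := ((n + m).choose m : ℝ) * t ^ m * (1 - t) ^ n

/-- the weight -/
noncomputable def ww (p t : ℝ) : ℝ := (1 - t) ^ (1 / p - 1) * t ^ (-(1 / p))

/-- the matrix -/
noncomputable def KK (μ : Measure ℝ) (n m : ℕ) : ENNReal :=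
  ∫⁻ t in Ioo (0 : ℝ) 1, ENNReal.ofReal (kk n m t) ∂μ

lemma kk_nonneg (n m : ℕ) {t : ℝ} (ht : t ∈ Ioo (0 : ℝ) 1) : 0 ≤ kk n m t := by
  have h1 : 0 ≤ 1 - t := by linarith [ht.2]
  have h2 := ht.1.le
  unfold kk; positivity

lemma kk_meas (n m : ℕ) : Measurable (kk n m) := by unfold kk; fun_prop

lemma ww_meas (p : ℝ) : Measurable (ww p) := by unfold ww; fun_prop

lemma ww_pos (p : ℝ) {t : ℝ} (ht : t ∈ Ioo (0 : ℝ) 1) : 0 < ww p t := by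
  have h1 : 0 < 1 - t := by linarith [ht.2]
  have h2 := ht.1
  unfold ww; positivity

lemma hs_conv {f g : ℕ → ℝ} {a b : ℝ} (h : HasSum f a) (h1 : ∀ n, g n = f n) (h2 : b = a) :
    HasSum g b := by
  rw [h2, show g = f from funext h1]; exact h

lemma kk_row (n : ℕ) {t : ℝ} (ht : t ∈ Ioo (0 : ℝ) 1) :
    HasSum (fun m => kk n m t) (1 - t)⁻¹ := by
  have h1 : 0 < 1 - t := by linarith [ht.2]
  have h := (hasSum_choose_mul_geometric_of_norm_lt_one (𝕜 := ℝ) n (r := t)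
    (by rw [Real.norm_eq_abs, abs_of_pos ht.1]; exact ht.2)).mul_right ((1 - t) ^ n)
  refine hs_conv h (fun m => ?_) ?_
  · show kk n m t = _
    unfold kk
    rw [add_comm m n, Nat.choose_symm_add]
  · rw [pow_succ']
    field_simp

lemma kk_col (m : ℕ) {t : ℝ} (ht : t ∈ Ioo (0 : ℝ) 1) :
    HasSum (fun n => kk n m t) t⁻¹ := by
  have h1 : 0 < 1 - t := by linarith [ht.2]
  have h0 := ht.1
  have h := (hasSum_choose_mul_geometric_of_norm_lt_one (𝕜 := ℝ) m (r := 1 - t)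
    (by rw [Real.norm_eq_abs, abs_of_pos h1]; linarith)).mul_right (t ^ m)
  refine hs_conv h (fun n => ?_) ?_
  · show kk n m t = _
    unfold kk
    ring
  · rw [sub_sub_cancel, pow_succ']
    field_simp

lemma kk_mean (n : ℕ) {t : ℝ} (ht : t ∈ Ioo (0 : ℝ) 1) :
    HasSum (fun m : ℕ => (m : ℝ) * kk n m t) ((1 - t)⁻¹ * ((n + 1) * t / (1 - t))) := by
  have h1 : 0 < 1 - t := by linarith [ht.2]
  have h := (hasSum_nat_add_iff (f := fun m : ℕ => (m : ℝ) * kk n m t) 1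
    (g := ((1 - t)⁻¹ * ((n + 1) * t / (1 - t))))).1 (by
      have := (kk_row (n + 1) ht).mul_right ((n + 1) * t / (1 - t))
      refine hs_conv this (fun m => ?_) rfl
      show ((m + 1 : ℕ) : ℝ) * kk n (m + 1) t = _
      have hc : ((m + 1 : ℕ) : ℝ) * ((n + (m + 1)).choose (m + 1) : ℝ)
          = ((n : ℝ) + 1) * ((n + 1 + m).choose m : ℝ) := by
        have e1 := Nat.choose_succ_right_eq (n + 1 + m) m
        rw [show n + 1 + m - m = n + 1 by omega] at e1
        rw [show n + (m + 1) = n + 1 + m by omega]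
        have : (((n + 1 + m).choose (m + 1) * (m + 1) : ℕ) : ℝ)
          = (((n + 1 + m).choose m * (n + 1) : ℕ) : ℝ) := by rw [e1]
        push_cast at this ⊢
        linarith
      unfold kk
      rw [← mul_assoc, ← mul_assoc, hc, pow_succ, pow_succ]
      field_simp)
  simpa using h

lemma KK_ne_top (μ : Measure ℝ) [IsFiniteMeasure μ] (n m : ℕ) : KK μ n m ≠ ⊤ := by
  have : KK μ n m ≤ ∫⁻ t in Ioo (0 : ℝ) 1, ENNReal.ofReal ((n + m).choose m : ℝ) ∂μ := by
    apply setLIntegral_mono' measurableSet_Ioo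
    intro t ht
    apply ENNReal.ofReal_le_ofReal
    have h1 : 0 ≤ 1 - t := by linarith [ht.2]
    unfold kk
    have a1 : t ^ m ≤ 1 := pow_le_one₀ ht.1.le ht.2.le
    have a2 : (1 - t) ^ n ≤ 1 := pow_le_one₀ h1 (by linarith [ht.1])
    have a3 : 0 ≤ t ^ m := pow_nonneg ht.1.le _
    calc _ ≤ ((n + m).choose m : ℝ) * 1 * 1 := by gcongr
      _ = _ := by ring
  refine ne_top_of_le_ne_top ?_ this
  rw [lintegral_const]
  exact ENNReal.mul_ne_top ENNReal.ofReal_ne_top (measure_ne_top _ _)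

lemma Hmu_eq (μ : Measure ℝ) (a : ℕ → ℂ) (n : ℕ) :
    Hmu μ a n = ∑' m, (KK μ n m).toReal • a m := by
  unfold Hmu
  congr 1; funext m
  have := integral_smul_const (μ := μ.restrict (Ioo 0 1)) (fun t => kk n m t) (a m)
  unfold kk at this
  rw [this]
  congr 1
  rw [integral_eq_lintegral_of_nonneg_ae]
  · rfl
  · filter_upwards [ae_restrict_mem measurableSet_Ioo] with t ht using kk_nonneg n m ht
  · exact (kk_meas n m).aestronglyMeasurable

lemma holder_aux (ν : Measure ℝ) [SFinite ν] (p : ℝ) (hp : 1 ≤ p) (f g : ℕ → ℝ → ENNReal)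
    (hf : ∀ m, Measurable (f m)) (hg : ∀ m, Measurable (g m)) :
    (∑' m, ∫⁻ t, f m t * g m t ∂ν) ^ p ≤
      (∑' m, ∫⁻ t, f m t * g m t ^ p ∂ν) * (∑' m, ∫⁻ t, f m t ∂ν) ^ (p - 1) := by
  have hp0 : 0 < p := by linarith
  set F : ℕ × ℝ → ENNReal := fun z => f z.1 z.2 with hF
  set G : ℕ × ℝ → ENNReal := fun z => g z.1 z.2 with hG
  have mF : Measurable F := measurable_from_prod_countable_right hf
  have mG : Measurable G := measurable_from_prod_countable_right hg
  have key : ∀ P : ℕ × ℝ → ENNReal, Measurable P →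
      ∫⁻ z, P z ∂((Measure.count : Measure ℕ).prod ν) = ∑' m, ∫⁻ t, P (m, t) ∂ν := by
    intro P hP
    rw [lintegral_prod _ hP.aemeasurable, lintegral_count]
  have := eLpNorm'_le_eLpNorm'_mul_rpow_measure_univ
    (μ := ((Measure.count : Measure ℕ).prod ν).withDensity F) (f := G) one_pos hp
    mG.aestronglyMeasurable
  unfold eLpNorm' at this
  simp only [enorm_eq_self, ENNReal.rpow_one, div_one] at this
  rw [lintegral_withDensity_eq_lintegral_mul _ mF mG,
    lintegral_withDensity_eq_lintegral_mul _ mF (mG.pow_const p),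
    withDensity_apply _ MeasurableSet.univ, Measure.restrict_univ, key _ (mF.mul mG),
    key _ (mF.mul (mG.pow_const p)), key _ mF] at this
  simp only [Pi.mul_apply, hF, hG] at this
  refine (ENNReal.rpow_le_rpow this hp0.le).trans ?_
  rw [ENNReal.mul_rpow_of_nonneg _ _ hp0.le, ← ENNReal.rpow_mul, ← ENNReal.rpow_mul,
    one_div_mul_cancel hp0.ne', ENNReal.rpow_one, sub_mul, one_mul, one_div_mul_cancel hp0.ne']

lemma ww_id (p : ℝ) (hp : 1 ≤ p) {t : ℝ} (ht : t ∈ Ioo (0 : ℝ) 1) :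
    t⁻¹ * ((1 - t) * ww p t) * (((1 - t) * ww p t)⁻¹) ^ p = ww p t := by
  have h1 : 0 < 1 - t := by linarith [ht.2]
  have h0 := ht.1
  have hw := ww_pos p ht
  have hp0 : p ≠ 0 := by linarith
  have e : ((1 - t) * ww p t) ^ p = (1 - t) * t⁻¹ := by
    rw [Real.mul_rpow h1.le hw.le]
    unfold ww
    rw [Real.mul_rpow (by positivity) (by positivity), ← Real.rpow_mul h1.le,
      ← Real.rpow_mul h0.le, ← mul_assoc, ← Real.rpow_add h1]
    rw [show p + (1 / p - 1) * p = 1 by field_simp; ring,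
      show -(1 / p) * p = -1 by field_simp, Real.rpow_one, Real.rpow_neg_one]
  rw [Real.inv_rpow (by positivity), e]
  field_simp

lemma schur (μ : Measure ℝ) [IsFiniteMeasure μ] (p : ℝ) (hp : 1 ≤ p) (A : ℕ → ENNReal) :
    ∑' n, (∑' m, KK μ n m * A m) ^ p ≤
      (∫⁻ t in Ioo (0 : ℝ) 1, ENNReal.ofReal (ww p t) ∂μ) ^ p * ∑' m, A m ^ p := by
  have hp0 : 0 < p := by linarith
  set C := ∫⁻ t in Ioo (0 : ℝ) 1, ENNReal.ofReal (ww p t) ∂μ with hC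
  let f : ℕ → ℕ → ℝ → ENNReal := fun n m t => ENNReal.ofReal (kk n m t * ((1 - t) * ww p t))
  let g : ℕ → ℝ → ENNReal := fun m t => A m * ENNReal.ofReal (((1 - t) * ww p t)⁻¹)
  have hf : ∀ n m, Measurable (f n m) := fun n m => by
    have := kk_meas n m
    have := ww_meas p
    fun_prop
  have hg : ∀ m, Measurable (g m) := fun m => by
    have := ww_meas p
    fun_prop
  have step1 : ∀ n m, KK μ n m * A m = ∫⁻ t in Ioo (0 : ℝ) 1, f n m t * g m t ∂μ := by
    intro n m
    unfold KK
    rw [← lintegral_mul_const _ (kk_meas n m).ennreal_ofReal]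
    apply setLIntegral_congr_fun measurableSet_Ioo
    intro t ht
    have h1 : 0 < 1 - t := by linarith [ht.2]
    have hw := ww_pos p ht
    have hk := kk_nonneg n m ht
    simp only [f, g]
    rw [mul_left_comm, ← ENNReal.ofReal_mul (by positivity), mul_assoc, mul_inv_cancel₀ (by positivity),
      mul_one, mul_comm]
  have step2 : ∀ n, ∑' m, ∫⁻ t in Ioo (0 : ℝ) 1, f n m t ∂μ = C := by
    intro n
    rw [← lintegral_tsum (fun m => (hf n m).aemeasurable)]
    apply setLIntegral_congr_fun measurableSet_Ioo
    intro t ht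
    have h1 : 0 < 1 - t := by linarith [ht.2]
    have hw := ww_pos p ht
    simp only [f]
    have hs := (kk_row n ht).mul_right ((1 - t) * ww p t)
    rw [← ENNReal.ofReal_tsum_of_nonneg (fun m => mul_nonneg (kk_nonneg n m ht) (by positivity))
      hs.summable, hs.tsum_eq]
    congr 1
    field_simp
  have step3 : ∑' n, ∑' m, ∫⁻ t in Ioo (0 : ℝ) 1, f n m t * g m t ^ p ∂μ = C * ∑' m, A m ^ p := by
    rw [ENNReal.tsum_comm, ← ENNReal.tsum_mul_left]
    congr 1; funext m
    rw [← lintegral_tsum (f := fun n t => f n m t * g m t ^ p)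
        (fun n => ((hf n m).mul ((hg m).pow_const p)).aemeasurable),
      hC, ← lintegral_mul_const _ (ww_meas p).ennreal_ofReal]
    apply setLIntegral_congr_fun measurableSet_Ioo
    intro t ht
    have h1 : 0 < 1 - t := by linarith [ht.2]
    have hw := ww_pos p ht
    simp only [f, g]
    have hs := (kk_col m ht).mul_right ((1 - t) * ww p t)
    rw [ENNReal.tsum_mul_right, ← ENNReal.ofReal_tsum_of_nonneg
      (fun n => mul_nonneg (kk_nonneg n m ht) (by positivity))
      hs.summable, hs.tsum_eq, ENNReal.mul_rpow_of_nonneg _ _ hp0.le, mul_left_comm,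
      ENNReal.ofReal_rpow_of_nonneg (by positivity) hp0.le,
      ← ENNReal.ofReal_mul (by have := ht.1; positivity), ww_id p hp ht, mul_comm]
  calc _ ≤ ∑' n, (∑' m, ∫⁻ t in Ioo (0 : ℝ) 1, f n m t * g m t ^ p ∂μ) * C ^ (p - 1) := by
        apply ENNReal.tsum_le_tsum
        intro n
        simp_rw [step1]
        rw [← step2 n]
        exact holder_aux _ p hp _ _ (hf n) hg
    _ = _ := by
        rw [ENNReal.tsum_mul_right, step3]
        rw [mul_right_comm]
        congr 1
        nth_rewrite 1 [← ENNReal.rpow_one C]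
        rw [← ENNReal.rpow_add_of_nonneg _ _ zero_le_one (by linarith)]
        congr 1; ring

lemma ofReal_norm_rpow (x : ℂ) {p : ℝ} (hp : 0 ≤ p) : ENNReal.ofReal (‖x‖ ^ p) = ‖x‖ₑ ^ p := by
  rw [← ofReal_norm, ENNReal.ofReal_rpow_of_nonneg (norm_nonneg _) hp]

lemma bdd_of_fin (μ : Measure ℝ) [IsFiniteMeasure μ] (p : ℝ) (hp : 1 ≤ p) (a : ℕ → ℂ) :
    ∑' n : ℕ, ENNReal.ofReal (‖Hmu μ a n‖ ^ p) ≤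
      (∫⁻ t in Ioo (0 : ℝ) 1, ENNReal.ofReal (ww p t) ∂μ) ^ p *
        ∑' m : ℕ, ENNReal.ofReal (‖a m‖ ^ p) := by
  have hp0 : 0 ≤ p := by linarith
  simp_rw [ofReal_norm_rpow _ hp0]
  refine le_trans ?_ (schur μ p hp (fun m => ‖a m‖ₑ))
  apply ENNReal.tsum_le_tsum
  intro n
  apply ENNReal.rpow_le_rpow _ hp0
  rw [Hmu_eq]
  refine enorm_tsum_le_tsum_enorm.trans ?_
  apply ENNReal.tsum_le_tsum
  intro m
  rw [enorm_smul, Real.enorm_eq_ofReal ENNReal.toReal_nonneg, ENNReal.ofReal_toReal (KK_ne_top μ n m)]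

open Filter Topology

lemma tangent (s x y : ℝ) (hs : 0 ≤ s) (hx : 0 < x) (hy : 0 < y) :
    y ^ (-s) * (1 - s * (x / y - 1)) ≤ x ^ (-s) := by
  have h : x = y * (x / y) := by field_simp
  have hxy : 0 < x / y := by positivity
  conv_rhs => rw [h]
  rw [Real.mul_rpow hy.le hxy.le]
  gcongr
  rw [Real.rpow_def_of_pos hxy]
  have h1 := Real.add_one_le_exp (Real.log (x / y) * -s)
  have h2 := Real.log_le_sub_one_of_pos hxy
  nlinarith [mul_le_mul_of_nonneg_left h2 hs]

/-- the test function -/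
noncomputable def gg (s : ℝ) (N : ℕ) (t : ℝ) : ℝ := (1 - t)⁻¹ * (t / (1 - t) + 1 / (N + 1)) ^ (-s)

lemma gg_meas (s : ℝ) (N : ℕ) : Measurable (gg s N) := by unfold gg; fun_prop

lemma jensen (s : ℝ) (hs : 0 ≤ s) (N n : ℕ) (hn : N ≤ n) {t : ℝ} (ht : t ∈ Ioo (0 : ℝ) 1) :
    ENNReal.ofReal (((n : ℝ) + 1) ^ (-s) * gg s N t) ≤
      ∑' m : ℕ, ENNReal.ofReal (kk n m t * ((m : ℝ) + 1) ^ (-s)) := by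
  have h1 : 0 < 1 - t := by linarith [ht.2]
  have h0 := ht.1
  have hsum : Summable (fun m : ℕ => kk n m t * ((m : ℝ) + 1) ^ (-s)) := by
    refine Summable.of_nonneg_of_le (fun m => mul_nonneg (kk_nonneg n m ht) (by positivity))
      (fun m => ?_) (kk_row n ht).summable
    apply mul_le_of_le_one_right (kk_nonneg n m ht)
    apply Real.rpow_le_one_of_one_le_of_nonpos _ (by linarith)
    have : (0 : ℝ) ≤ m := by positivity
    linarith
  rw [← ENNReal.ofReal_tsum_of_nonneg
    (fun m => mul_nonneg (kk_nonneg n m ht) (by positivity)) hsum]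
  apply ENNReal.ofReal_le_ofReal
  set y : ℝ := (n + 1) * t / (1 - t) + 1 with hy
  have hy0 : 0 < y := by positivity
  have hA := (kk_row n ht).mul_right (y ^ (-s) * (1 + s - s / y))
  have hB := (kk_mean n ht).mul_right (y ^ (-s) * (s / y))
  have hAB := hA.sub hB
  have e : (1 - t)⁻¹ * (y ^ (-s) * (1 + s - s / y)) -
      (1 - t)⁻¹ * ((n + 1) * t / (1 - t)) * (y ^ (-s) * (s / y)) = (1 - t)⁻¹ * y ^ (-s) := by
    rw [show ((n : ℝ) + 1) * t / (1 - t) = y - 1 by rw [hy]; ring]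
    generalize y ^ (-s) = Y
    field_simp
    ring
  rw [e] at hAB
  calc _ ≤ (1 - t)⁻¹ * y ^ (-s) := by
        have e2 : y = (n + 1) * (t / (1 - t) + 1 / (n + 1)) := by rw [hy]; field_simp
        rw [e2, Real.mul_rpow (by positivity) (by positivity)]
        unfold gg
        rw [mul_left_comm]
        have : (t / (1 - t) + 1 / ((N : ℝ) + 1)) ^ (-s) ≤ (t / (1 - t) + 1 / ((n : ℝ) + 1)) ^ (-s) := by
          apply Real.rpow_le_rpow_of_nonpos (by positivity) _ (by linarith)
          gcongr
        gcongr
    _ ≤ _ := by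
        rw [← hAB.tsum_eq]
        apply hAB.summable.tsum_le_tsum _ hsum
        intro m
        have := mul_le_mul_of_nonneg_left (tangent s ((m : ℝ) + 1) y hs (by positivity) hy0)
          (kk_nonneg n m ht)
        refine le_trans (le_of_eq ?_) this
        field_simp
        ring

lemma trunc (μ : Measure ℝ) [IsFiniteMeasure μ] (p : ℝ) (hp : 1 ≤ p) (M : ℝ)
    (hM : ∀ a : ℕ → ℂ, Summable (fun m : ℕ => ‖a m‖ ^ p) →
        ∑' n : ℕ, ENNReal.ofReal (‖Hmu μ a n‖ ^ p) ≤
          ENNReal.ofReal M ^ p * ∑' m : ℕ, ENNReal.ofReal (‖a m‖ ^ p))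
    (A : ℕ → ℝ) (hA : ∀ m, 0 ≤ A m) :
    ∑' n, (∑' m, KK μ n m * ENNReal.ofReal (A m)) ^ p ≤
      ENNReal.ofReal M ^ p * ∑' m, ENNReal.ofReal (A m ^ p) := by
  have hp0 : 0 < p := by linarith
  have key : ∀ R : ℕ, ∑' n, (∑ m ∈ Finset.range R, KK μ n m * ENNReal.ofReal (A m)) ^ p ≤
      ENNReal.ofReal M ^ p * ∑' m, ENNReal.ofReal (A m ^ p) := by
    intro R
    let a : ℕ → ℂ := fun m => if m < R then (A m : ℂ) else 0
    have ha : ∀ m, m ∉ Finset.range R → a m = 0 := fun m hm => by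
      simp only [Finset.mem_range] at hm
      simp [a, hm]
    have hs : Summable (fun m : ℕ => ‖a m‖ ^ p) := by
      apply summable_of_ne_finset_zero (s := Finset.range R)
      intro m hm
      rw [ha m hm, norm_zero, Real.zero_rpow hp0.ne']
    have h := hM a hs
    refine le_trans (le_of_eq ?_) (h.trans ?_)
    · congr 1; funext n
      rw [ofReal_norm_rpow _ hp0.le]
      congr 1
      rw [Hmu_eq, tsum_eq_sum (s := Finset.range R) (fun m hm => by rw [ha m hm, smul_zero])]
      have : ∑ m ∈ Finset.range R, (KK μ n m).toReal • a m =
          ((∑ m ∈ Finset.range R, (KK μ n m).toReal * A m : ℝ) : ℂ) := by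
        push_cast
        apply Finset.sum_congr rfl
        intro m hm
        rw [Finset.mem_range] at hm
        simp [a, hm]
      rw [this, ← ofReal_norm, Complex.norm_real, ofReal_norm,
        Real.enorm_eq_ofReal (Finset.sum_nonneg fun m _ => mul_nonneg ENNReal.toReal_nonneg (hA m)),
        ENNReal.ofReal_sum_of_nonneg (fun m _ => mul_nonneg ENNReal.toReal_nonneg (hA m))]
      apply Finset.sum_congr rfl
      intro m _
      rw [ENNReal.ofReal_mul ENNReal.toReal_nonneg, ENNReal.ofReal_toReal (KK_ne_top μ n m)]
    · gcongr with m
      by_cases hm : m < R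
      · simp only [a, hm, if_true, Complex.norm_real, Real.norm_eq_abs]
        rw [abs_of_nonneg (hA m)]
      · simp only [a, hm, if_false, norm_zero]
        exact hA m
  rw [ENNReal.tsum_eq_iSup_nat]
  apply iSup_le
  intro N
  refine le_of_tendsto' (x := atTop) (f := fun R : ℕ => ∑ n ∈ Finset.range N,
    (∑ m ∈ Finset.range R, KK μ n m * ENNReal.ofReal (A m)) ^ p) ?_
    (fun R => (ENNReal.sum_le_tsum _).trans (key R))
  apply tendsto_finsetSum
  intro n _
  exact (ENNReal.continuous_rpow_const.tendsto _).comp (ENNReal.tendsto_nat_tsum _)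

lemma main_ineq (μ : Measure ℝ) [IsFiniteMeasure μ] (p : ℝ) (hp : 1 ≤ p) (M : ℝ)
    (hM : ∀ a : ℕ → ℂ, Summable (fun m : ℕ => ‖a m‖ ^ p) →
        ∑' n : ℕ, ENNReal.ofReal (‖Hmu μ a n‖ ^ p) ≤
          ENNReal.ofReal M ^ p * ∑' m : ℕ, ENNReal.ofReal (‖a m‖ ^ p))
    (N : ℕ) (σ : ℝ) (hσ : 1 < σ) :
    (∫⁻ t in Ioo (0 : ℝ) 1, ENNReal.ofReal (gg (σ / p) N t) ∂μ) ^ p *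
      ENNReal.ofReal ((σ - 1) * (∑' n : ℕ, 1 / (n : ℝ) ^ σ) - (σ - 1) * N) ≤
    ENNReal.ofReal M ^ p * ENNReal.ofReal ((σ - 1) * (∑' n : ℕ, 1 / (n : ℝ) ^ σ)) := by
  have hp0 : 0 < p := by linarith
  set s := σ / p with hs
  have hs0 : 0 ≤ s := by positivity
  set G := ∫⁻ t in Ioo (0 : ℝ) 1, ENNReal.ofReal (gg s N t) ∂μ with hG
  have hT := trunc μ p hp M hM (fun m => ((m : ℝ) + 1) ^ (-s)) (fun m => by positivity)
  have hAp : ∀ m : ℕ, (((m : ℝ) + 1) ^ (-s)) ^ p = 1 / ((m : ℝ) + 1) ^ σ := by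
    intro m
    rw [← Real.rpow_mul (by positivity), hs, show -(σ / p) * p = -σ by field_simp,
      Real.rpow_neg (by positivity), one_div]
  simp only [hAp] at hT
  have hZ0 : Summable (fun n : ℕ => 1 / (n : ℝ) ^ σ) := Real.summable_one_div_nat_rpow.2 hσ
  set Z := ∑' n : ℕ, 1 / (n : ℝ) ^ σ with hZ
  have hZ1 : HasSum (fun n : ℕ => 1 / ((n : ℝ) + 1) ^ σ) Z := by
    have := (hasSum_nat_add_iff' (f := fun n : ℕ => 1 / (n : ℝ) ^ σ) (g := Z) 1).2 hZ0.hasSum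
    simp only [Finset.sum_range_one, Nat.cast_zero, Real.zero_rpow (by linarith : σ ≠ 0), div_zero,
      sub_zero, Nat.cast_add, Nat.cast_one] at this
    exact this
  have hZ2 : HasSum (fun n : ℕ => 1 / (((n + N : ℕ) : ℝ) + 1) ^ σ)
      (Z - ∑ i ∈ Finset.range N, 1 / ((i : ℝ) + 1) ^ σ) :=
    (hasSum_nat_add_iff' (f := fun n : ℕ => 1 / ((n : ℝ) + 1) ^ σ) (g := Z) N).2 hZ1
  have hhead : ∑ i ∈ Finset.range N, 1 / ((i : ℝ) + 1) ^ σ ≤ N := by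
    calc _ ≤ ∑ i ∈ Finset.range N, (1 : ℝ) := by
          apply Finset.sum_le_sum
          intro i _
          rw [div_le_one (by positivity)]
          apply Real.one_le_rpow _ (by linarith)
          have : (0 : ℝ) ≤ i := by positivity
          linarith
      _ = N := by simp
  rw [← ENNReal.ofReal_tsum_of_nonneg (fun m => by positivity) hZ1.summable, hZ1.tsum_eq] at hT
  have hlow : ∀ n, N ≤ n → ENNReal.ofReal (((n : ℝ) + 1) ^ (-s)) * G ≤
      ∑' m : ℕ, KK μ n m * ENNReal.ofReal (((m : ℝ) + 1) ^ (-s)) := by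
    intro n hn
    unfold KK
    simp_rw [← lintegral_mul_const _ (kk_meas n _).ennreal_ofReal]
    rw [← lintegral_tsum (fun m => ((kk_meas n m).ennreal_ofReal.mul_const _).aemeasurable), hG,
      ← lintegral_const_mul _ (gg_meas s N).ennreal_ofReal]
    apply setLIntegral_mono' measurableSet_Ioo
    intro t ht
    rw [← ENNReal.ofReal_mul (by positivity)]
    refine (jensen s hs0 N n hn ht).trans (le_of_eq ?_)
    congr 1; funext m
    rw [ENNReal.ofReal_mul (kk_nonneg n m ht)]
  have hfin : G ^ p * ENNReal.ofReal (Z - N) ≤ ENNReal.ofReal M ^ p * ENNReal.ofReal Z := by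
    refine le_trans ?_ hT
    calc G ^ p * ENNReal.ofReal (Z - N)
        ≤ G ^ p * ∑' n : ℕ, ENNReal.ofReal (1 / (((n + N : ℕ) : ℝ) + 1) ^ σ) := by
          rw [← ENNReal.ofReal_tsum_of_nonneg (fun m => by positivity) hZ2.summable, hZ2.tsum_eq]
          gcongr
      _ = ∑' n : ℕ, (ENNReal.ofReal ((((n + N : ℕ) : ℝ) + 1) ^ (-s)) * G) ^ p := by
          rw [← ENNReal.tsum_mul_left]
          congr 1; funext n
          rw [ENNReal.mul_rpow_of_nonneg _ _ hp0.le,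
            ENNReal.ofReal_rpow_of_nonneg (by positivity) hp0.le, hAp, mul_comm]
      _ ≤ ∑' n : ℕ, (∑' m : ℕ, KK μ (n + N) m * ENNReal.ofReal (((m : ℝ) + 1) ^ (-s))) ^ p := by
          apply ENNReal.tsum_le_tsum
          intro n
          exact ENNReal.rpow_le_rpow (hlow _ (by omega)) hp0.le
      _ ≤ _ := ENNReal.tsum_comp_le_tsum_of_injective (add_left_injective N)
          (fun n => (∑' m : ℕ, KK μ n m * ENNReal.ofReal (((m : ℝ) + 1) ^ (-s))) ^ p)
  rw [← mul_sub, ENNReal.ofReal_mul (by linarith), ENNReal.ofReal_mul (by linarith),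
    mul_left_comm, mul_left_comm (ENNReal.ofReal M ^ p)]
  gcongr

lemma G_le (μ : Measure ℝ) [IsFiniteMeasure μ] (p : ℝ) (hp : 1 ≤ p) (M : ℝ)
    (hM : ∀ a : ℕ → ℂ, Summable (fun m : ℕ => ‖a m‖ ^ p) →
        ∑' n : ℕ, ENNReal.ofReal (‖Hmu μ a n‖ ^ p) ≤
          ENNReal.ofReal M ^ p * ∑' m : ℕ, ENNReal.ofReal (‖a m‖ ^ p))
    (N : ℕ) :
    (∫⁻ t in Ioo (0 : ℝ) 1, ENNReal.ofReal (gg (1 / p) N t) ∂μ) ≤ ENNReal.ofReal M := by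
  have hp0 : 0 < p := by linarith
  have hF : (∫⁻ t in Ioo (0 : ℝ) 1, ENNReal.ofReal (gg (1 / p) N t) ∂μ) ≤
      liminf (fun σ : ℝ => ∫⁻ t in Ioo (0 : ℝ) 1, ENNReal.ofReal (gg (σ / p) N t) ∂μ) (𝓝[>] 1) := by
    refine le_trans (le_of_eq ?_) (lintegral_liminf_le (fun σ => (gg_meas (σ / p) N).ennreal_ofReal))
    apply setLIntegral_congr_fun measurableSet_Ioo
    intro t ht
    have h1 : 0 < 1 - t := by linarith [ht.2]
    have h0 := ht.1
    refine (Tendsto.liminf_eq ?_).symm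
    apply ENNReal.tendsto_ofReal
    apply tendsto_nhdsWithin_of_tendsto_nhds
    have hb : 0 < t / (1 - t) + 1 / ((N : ℝ) + 1) := by positivity
    have : Continuous (fun σ : ℝ => gg (σ / p) N t) := by
      unfold gg
      refine continuous_const.mul (Continuous.rpow continuous_const (by fun_prop) ?_)
      intro x; left; exact hb.ne'
    exact this.tendsto 1
  refine hF.trans ?_
  apply le_of_forall_lt_imp_le_of_dense
  intro r hr
  have hev := eventually_lt_of_lt_liminf hr
  have hzeta := tendsto_sub_mul_tsum_nat_rpow
  have hσ : Tendsto (fun σ : ℝ => (σ - 1) * (N : ℝ)) (𝓝[>] 1) (𝓝 0) := by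
    apply tendsto_nhdsWithin_of_tendsto_nhds
    have : Continuous (fun σ : ℝ => (σ - 1) * (N : ℝ)) := by fun_prop
    simpa using this.tendsto 1
  have hl := ENNReal.tendsto_ofReal (hzeta.sub hσ)
  have hr' := ENNReal.tendsto_ofReal hzeta
  rw [sub_zero, ENNReal.ofReal_one] at hl
  rw [ENNReal.ofReal_one] at hr'
  have hl2 := ENNReal.Tendsto.const_mul (a := r ^ p) hl (Or.inl one_ne_zero)
  have hr2 := ENNReal.Tendsto.const_mul (a := ENNReal.ofReal M ^ p) hr' (Or.inl one_ne_zero)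
  rw [mul_one] at hl2 hr2
  have hle : r ^ p ≤ ENNReal.ofReal M ^ p := by
    refine le_of_tendsto_of_tendsto hl2 hr2 ?_
    filter_upwards [hev, self_mem_nhdsWithin] with σ h1 h2
    refine le_trans ?_ (main_ineq μ p hp M hM N σ h2)
    gcongr
  exact (ENNReal.rpow_le_rpow_iff hp0).1 hle

lemma C_le (μ : Measure ℝ) [IsFiniteMeasure μ] (p : ℝ) (hp : 1 ≤ p) (M : ℝ)
    (hM : ∀ a : ℕ → ℂ, Summable (fun m : ℕ => ‖a m‖ ^ p) →
        ∑' n : ℕ, ENNReal.ofReal (‖Hmu μ a n‖ ^ p) ≤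
          ENNReal.ofReal M ^ p * ∑' m : ℕ, ENNReal.ofReal (‖a m‖ ^ p)) :
    (∫⁻ t in Ioo (0 : ℝ) 1, ENNReal.ofReal (ww p t) ∂μ) ≤ ENNReal.ofReal M := by
  have hp0 : 0 < p := by linarith
  have hF : (∫⁻ t in Ioo (0 : ℝ) 1, ENNReal.ofReal (ww p t) ∂μ) ≤
      liminf (fun N : ℕ => ∫⁻ t in Ioo (0 : ℝ) 1, ENNReal.ofReal (gg (1 / p) N t) ∂μ) atTop := by
    refine le_trans (le_of_eq ?_) (lintegral_liminf_le (fun N => (gg_meas (1 / p) N).ennreal_ofReal))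
    apply setLIntegral_congr_fun measurableSet_Ioo
    intro t ht
    have h1 : 0 < 1 - t := by linarith [ht.2]
    have h0 := ht.1
    refine (Tendsto.liminf_eq ?_).symm
    apply ENNReal.tendsto_ofReal
    have e : ww p t = (1 - t)⁻¹ * (t / (1 - t) + 0) ^ (-(1 / p)) := by
      unfold ww
      rw [add_zero, Real.div_rpow h0.le h1.le, Real.rpow_sub h1, Real.rpow_neg h1.le, Real.rpow_one]
      field_simp
    rw [e]
    unfold gg
    apply Tendsto.const_mul
    apply Tendsto.rpow_const
    · exact tendsto_const_nhds.add tendsto_one_div_add_atTop_nhds_zero_nat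
    · left; positivity
  refine hF.trans ?_
  refine (liminf_le_liminf (v := fun _ : ℕ => ENNReal.ofReal M)
    (Eventually.of_forall (fun N => G_le μ p hp M hM N))).trans (le_of_eq ?_)
  exact liminf_const _

/-- For `1 ≤ p < ∞`, `H_μ` is bounded on `ℓ^p` iff
`C_μ(p) = ∫_{(0,1)} (1-t)^{1/p-1} t^{-1/p} dμ(t) < ∞`, and in that case the operator norm
(the least bound `M`) equals `C_μ(p)`. -/
theorem Hmu_bounded_lp_iff (μ : Measure ℝ) [IsFiniteMeasure μ] (p : ℝ) (hp : 1 ≤ p) :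
    ((∃ M : ℝ, 0 ≤ M ∧ ∀ a : ℕ → ℂ, Summable (fun m : ℕ => ‖a m‖ ^ p) →
        ∑' n : ℕ, ENNReal.ofReal (‖Hmu μ a n‖ ^ p) ≤
          ENNReal.ofReal M ^ p * ∑' m : ℕ, ENNReal.ofReal (‖a m‖ ^ p)) ↔
      (∫⁻ t in Ioo (0 : ℝ) 1,
        ENNReal.ofReal ((1 - t) ^ (1 / p - 1) * t ^ (-(1 / p))) ∂μ) ≠ ⊤) ∧
    ((∃ M : ℝ, 0 ≤ M ∧ ∀ a : ℕ → ℂ, Summable (fun m : ℕ => ‖a m‖ ^ p) →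
        ∑' n : ℕ, ENNReal.ofReal (‖Hmu μ a n‖ ^ p) ≤
          ENNReal.ofReal M ^ p * ∑' m : ℕ, ENNReal.ofReal (‖a m‖ ^ p)) →
      IsLeast {M : ℝ | 0 ≤ M ∧ ∀ a : ℕ → ℂ, Summable (fun m : ℕ => ‖a m‖ ^ p) →
          ∑' n : ℕ, ENNReal.ofReal (‖Hmu μ a n‖ ^ p) ≤
            ENNReal.ofReal M ^ p * ∑' m : ℕ, ENNReal.ofReal (‖a m‖ ^ p)}
        (∫⁻ t in Ioo (0 : ℝ) 1,
          ENNReal.ofReal ((1 - t) ^ (1 / p - 1) * t ^ (-(1 / p))) ∂μ).toReal) := by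
  have hC := fun M => C_le μ p hp M
  have hB := fun a => bdd_of_fin μ p hp a
  unfold ww at hC hB
  set C := ∫⁻ t in Ioo (0 : ℝ) 1,
        ENNReal.ofReal ((1 - t) ^ (1 / p - 1) * t ^ (-(1 / p))) ∂μ
  refine ⟨⟨?_, ?_⟩, ?_⟩
  · rintro ⟨M, _, hM⟩
    exact ne_top_of_le_ne_top ENNReal.ofReal_ne_top (hC M hM)
  · intro h
    refine ⟨C.toReal, ENNReal.toReal_nonneg, fun a _ => ?_⟩
    rw [ENNReal.ofReal_toReal h]
    exact hB a
  · rintro ⟨M, _, hM⟩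
    have h := ne_top_of_le_ne_top ENNReal.ofReal_ne_top (hC M hM)
    refine ⟨⟨ENNReal.toReal_nonneg, fun a _ => ?_⟩, ?_⟩
    · rw [ENNReal.ofReal_toReal h]
      exact hB a
    · rintro M' ⟨hM0, hM'⟩
      exact ENNReal.toReal_le_of_le_ofReal hM0 (hC M' hM')
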